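/- Simulation characterization for CTP path formulas: for every CTP path formula α, every tree T, and all nodes n, n' of T, one has (n,n')∈⟦α⟧_T if and only if there exists a simulation from the conditional tree pattern ct(α) into the pointed tree (T.n, n) which maps the output node of ct(α) to n'. -/

import Mathlib

/- Trees over a label alphabet -/
structure RTree (A : Type) where
  Node : Type
  E : Node → Node → Prop
  root : Node
  label : Node → Set A

namespace RTree
variable {A : Type}

/-- Tree axioms not requiring finiteness of the node set: finite label sets,
    connectedness from the root, unique parents, acyclicity. -/
def IsPreTree (T : RTree A) : Prop :=
  (∀ n, (T.label n).Finite) ∧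
  (∀ n, Relation.ReflTransGen T.E T.root n) ∧
  (∀ n m m', T.E m n → T.E m' n → m = m') ∧
  (∀ n, ¬ Relation.TransGen T.E n n)

/-- A (finite, rooted, unranked) tree. -/
def IsTree (T : RTree A) : Prop := T.IsPreTree ∧ Finite T.Node

/-- Single-labeled (XML) trees: every node carries exactly one label. -/
def SingleLabeled (T : RTree A) : Prop := ∀ n, ∃ p, T.label n = {p}

end RTree

/- Conditional Tree Patterns: node formulas and path formulas.
   `cstar φ` is the conditional descendant path (↓;?φ)*;↓. -/
mutual
inductive CNF (A : Type) : Type where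
  | lab : A → CNF A
  | top : CNF A
  | and : CNF A → CNF A → CNF A
  | dia : CPF A → CNF A → CNF A
inductive CPF (A : Type) : Type where
  | child : CPF A
  | test : CNF A → CPF A
  | comp : CPF A → CPF A → CPF A
  | cstar : CNF A → CPF A
end

variable {A : Type}

mutual
/-- Satisfaction of CTP node formulas: the set of nodes where the formula holds. -/
def CNF.sat (T : RTree A) : CNF A → Set T.Node
  | .lab p => {n | p ∈ T.label n}
  | .top => Set.univ
  | .and φ ψ => {n | n ∈ CNF.sat T φ ∧ n ∈ CNF.sat T ψ}
  | .dia α φ => {n | ∃ m, CPF.sem T α n m ∧ m ∈ CNF.sat T φ}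
/-- Semantics of CTP path formulas: ⟦(↓;?φ)*;↓⟧ = (E∘⟦?φ⟧)*∘E. -/
def CPF.sem (T : RTree A) : CPF A → T.Node → T.Node → Prop
  | .child => T.E
  | .test φ => fun n m => n = m ∧ n ∈ CNF.sat T φ
  | .comp α β => fun n m => ∃ k, CPF.sem T α n k ∧ CPF.sem T β k m
  | .cstar φ => fun n m =>
      ∃ k, Relation.ReflTransGen (fun a b => T.E a b ∧ b ∈ CNF.sat T φ) n k ∧ T.E k m
end

/-- The subtree of `T` rooted at `n`. -/
def RTree.subtree (T : RTree A) (n : T.Node) : RTree A where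
  Node := {m : T.Node // Relation.ReflTransGen T.E n m}
  E a b := T.E a.1 b.1
  root := ⟨n, Relation.ReflTransGen.refl⟩
  label m := T.label m.1

/-- Boolean conditional tree patterns: a finite tree whose nodes carry a set of
labels, and whose edges carry either `none` (a child edge ↓) or `some t` with
`t` a Boolean conditional tree pattern (a conditional descendant edge).  The
sole output node of a Boolean pattern is its root. -/
inductive BPat (A : Type) : Type where
  | mk : Set A → List (Option (BPat A) × BPat A) → BPat A

/-- Conditional tree patterns with one output node: a Boolean pattern together
with a marked path from the root to the output node (the spine).  `here s ch`
is a pattern whose output node is its root; `step s ch el rest` is a pattern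
whose root has label set `s`, side subtrees `ch`, and one more edge labeled
`el` towards the subpattern `rest` containing the output node. -/
inductive OPat (A : Type) : Type where
  | here : Set A → List (Option (BPat A) × BPat A) → OPat A
  | step : Set A → List (Option (BPat A) × BPat A) → Option (BPat A) → OPat A → OPat A

mutual
/-- There exists a simulation from the Boolean pattern into the pointed tree
`(T, n)`: the root is mapped to `n`, labels are preserved, child edges are
mapped to child edges, and a conditional edge labeled by a Boolean pattern `c`
is mapped to a descendant edge all of whose intermediate nodes `z` admit a
simulation of `c` into the subtree `T.z`. -/
def SimB (T : RTree A) (p : BPat A) (n : T.Node) : Prop :=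
  match p with
  | .mk s ch => s ⊆ T.label n ∧ SimL T ch n
/-- Simulations for a list of outgoing (labeled) edges of a pattern node. -/
def SimL (T : RTree A) (l : List (Option (BPat A) × BPat A)) (n : T.Node) : Prop :=
  match l with
  | [] => True
  | (none, t) :: r => (∃ m, T.E n m ∧ SimB T t m) ∧ SimL T r n
  | (some c, t) :: r =>
      (∃ m, Relation.TransGen T.E n m ∧ SimB T t m ∧
        ∀ z, Relation.TransGen T.E n z → Relation.TransGen T.E z m →
          SimB (T.subtree z) c (T.subtree z).root) ∧ SimL T r n
end

mutual
/-- There exists a simulation from the one-output pattern into the pointed tree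
`(T, n)` mapping the output node to `out`. -/
def SimO (T : RTree A) (p : OPat A) (n out : T.Node) : Prop :=
  match p with
  | .here s ch => out = n ∧ s ⊆ T.label n ∧ SimL T ch n
  | .step s ch el rest =>
      s ⊆ T.label n ∧ SimL T ch n ∧
      match el with
      | none => ∃ m, T.E n m ∧ SimO T rest m out
      | some c =>
          ∃ m, Relation.TransGen T.E n m ∧ SimO T rest m out ∧
            ∀ z, Relation.TransGen T.E n z → Relation.TransGen T.E z m →
              SimB (T.subtree z) c (T.subtree z).root
end

/-- Fusion of two Boolean patterns at the root. -/
def BPat.fuse : BPat A → BPat A → BPat A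
  | .mk s ch, .mk s' ch' => .mk (s ∪ s') (ch ++ ch')

/-- Fuse a Boolean pattern onto the output node of a one-output pattern,
forgetting the output marking (the result is a Boolean pattern). -/
def OPat.graft : OPat A → BPat A → BPat A
  | .here s ch, .mk s' ch' => .mk (s ∪ s') (ch ++ ch')
  | .step s ch el rest, b => .mk s (ch ++ [(el, OPat.graft rest b)])

/-- Composition of one-output patterns: fuse the root of the second onto the
output node of the first; the output node of the second becomes the output. -/
def OPat.comp : OPat A → OPat A → OPat A
  | .here s ch, .here s' ch' => .here (s ∪ s') (ch ++ ch')
  | .here s ch, .step s' ch' el rest => .step (s ∪ s') (ch ++ ch') el rest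
  | .step s ch el rest, q => .step s ch el (OPat.comp rest q)

mutual
/-- The translation `ct` of CTP node formulas into Boolean conditional tree
patterns. -/
def ctN : CNF A → BPat A
  | .lab p => .mk {p} []
  | .top => .mk ∅ []
  | .and φ ψ => BPat.fuse (ctN φ) (ctN ψ)
  | .dia α φ => OPat.graft (ctP α) (ctN φ)
/-- The translation `ct` of CTP path formulas into conditional tree patterns
with one output node. -/
def ctP : CPF A → OPat A
  | .child => .step ∅ [] none (.here ∅ [])
  | .test φ =>
      match ctN φ with
      | .mk s ch => .here s ch
  | .comp α β => OPat.comp (ctP α) (ctP β)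
  | .cstar φ => .step ∅ [] (some (ctN φ)) (.here ∅ [])
end

structure Emb (T T' : RTree A) (f : T.Node → T'.Node) : Prop where
  inj : Function.Injective f
  lab : ∀ n, T'.label (f n) = T.label n
  e : ∀ {a b}, T.E a b → T'.E (f a) (f b)
  back : ∀ {a b}, T'.E (f a) b → ∃ b', f b' = b ∧ T.E a b'

namespace Emb
open Relation
variable {T T' : RTree A} {f : T.Node → T'.Node}

theorem tg (h : Emb T T' f) {a b} (hab : TransGen T.E a b) : TransGen T'.E (f a) (f b) :=
  TransGen.lift f (fun _ _ => h.e) _ _ hab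

theorem rtg (h : Emb T T' f) {a b} (hab : ReflTransGen T.E a b) :
    ReflTransGen T'.E (f a) (f b) :=
  ReflTransGen.lift f (fun _ _ => h.e) _ _ hab

theorem tgback (h : Emb T T' f) {a b} (hab : TransGen T'.E (f a) b) :
    ∃ b', f b' = b ∧ TransGen T.E a b' := by
  induction hab with
  | single hh => obtain ⟨b', h1, h2⟩ := h.back hh; exact ⟨b', h1, .single h2⟩
  | tail _ hh ih =>
    obtain ⟨c, rfl, h2⟩ := ih
    obtain ⟨b', h1, h3⟩ := h.back hh
    exact ⟨b', h1, h2.tail h3⟩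

theorem rtgback (h : Emb T T' f) {a b} (hab : ReflTransGen T'.E (f a) b) :
    ∃ b', f b' = b ∧ ReflTransGen T.E a b' := by
  rcases Relation.reflTransGen_iff_eq_or_transGen.1 hab with rfl | hh
  · exact ⟨a, rfl, .refl⟩
  · obtain ⟨b', h1, h2⟩ := h.tgback hh
    exact ⟨b', h1, h2.to_reflTransGen⟩

theorem tg_iff (h : Emb T T' f) {a b} : TransGen T'.E (f a) (f b) ↔ TransGen T.E a b := by
  refine ⟨fun hh => ?_, h.tg⟩
  obtain ⟨b', h1, h2⟩ := h.tgback hh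
  rw [← h.inj h1]; exact h2

theorem sub (T : RTree A) (n : T.Node) : Emb (T.subtree n) T Subtype.val where
  inj := Subtype.val_injective
  lab _ := rfl
  e h := h
  back {a b} h := ⟨⟨b, a.2.tail h⟩, rfl, h⟩

theorem ex_child (h : Emb T T' f) {n} {P : T.Node → Prop} {Q : T'.Node → Prop}
    (hPQ : ∀ m, P m ↔ Q (f m)) : (∃ m, T.E n m ∧ P m) ↔ (∃ m, T'.E (f n) m ∧ Q m) := by
  constructor
  · rintro ⟨m, h1, h2⟩; exact ⟨f m, h.e h1, (hPQ m).1 h2⟩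
  · rintro ⟨m, h1, h2⟩
    obtain ⟨m, rfl, h3⟩ := h.back h1
    exact ⟨m, h3, (hPQ m).2 h2⟩

theorem ex_desc (h : Emb T T' f) {n} {P R : T.Node → Prop} {Q S : T'.Node → Prop}
    (hPQ : ∀ m, P m ↔ Q (f m)) (hRS : ∀ m, R m ↔ S (f m)) :
    (∃ m, TransGen T.E n m ∧ P m ∧ ∀ z, TransGen T.E n z → TransGen T.E z m → R z) ↔
    (∃ m, TransGen T'.E (f n) m ∧ Q m ∧
      ∀ z, TransGen T'.E (f n) z → TransGen T'.E z m → S z) := by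
  constructor
  · rintro ⟨m, h1, h2, h3⟩
    refine ⟨f m, h.tg h1, (hPQ m).1 h2, fun z hz hm => ?_⟩
    obtain ⟨z, rfl, hz'⟩ := h.tgback hz
    exact (hRS z).1 (h3 z hz' (h.tg_iff.1 hm))
  · rintro ⟨m, h1, h2, h3⟩
    obtain ⟨m, rfl, h4⟩ := h.tgback h1
    exact ⟨m, h4, (hPQ m).2 h2, fun z hz hm => (hRS z).2 (h3 _ (h.tg hz) (h.tg hm))⟩
end Emb

mutual
theorem simB_emb (p : BPat A) {T T' : RTree A} {f : T.Node → T'.Node} (h : Emb T T' f)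
    (n : T.Node) : SimB T p n ↔ SimB T' p (f n) := by
  match p with
  | .mk s ch => rw [SimB, SimB, h.lab, simL_emb ch h n]
theorem simL_emb (l : List (Option (BPat A) × BPat A)) {T T' : RTree A}
    {f : T.Node → T'.Node} (h : Emb T T' f)
    (n : T.Node) : SimL T l n ↔ SimL T' l (f n) := by
  match l with
  | [] => simp [SimL]
  | (none, t) :: r =>
    rw [SimL, SimL, simL_emb r h n, h.ex_child (fun m => simB_emb t h m)]
  | (some c, t) :: r =>
    rw [SimL, SimL, simL_emb r h n, h.ex_desc (Q := fun m => SimB T' t m)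
      (S := fun z => SimB (T'.subtree z) c (T'.subtree z).root) (fun m => simB_emb t h m)
      (fun z => ((simB_emb c (Emb.sub T z) (T.subtree z).root).trans
        (simB_emb c h z)).trans
        (simB_emb c (Emb.sub T' (f z)) (T'.subtree (f z)).root).symm)]
end

theorem simB_sub (T : RTree A) (c : BPat A) (z : T.Node) :
    SimB (T.subtree z) c (T.subtree z).root ↔ SimB T c z :=
  simB_emb c (Emb.sub T z) (T.subtree z).root

theorem simO_emb (p : OPat A) {T T' : RTree A} {f : T.Node → T'.Node} (h : Emb T T' f)
    (n out : T.Node) : SimO T p n out ↔ SimO T' p (f n) (f out) := by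
  induction p generalizing n with
  | here s ch => rw [SimO, SimO, h.lab, simL_emb ch h n, h.inj.eq_iff]
  | step s ch el rest ih =>
    cases el with
    | none => simp only [SimO]; rw [h.lab, simL_emb ch h n, h.ex_child (Q := fun m => SimO T' rest m (f out)) (fun m => ih m)]
    | some c =>
      simp only [SimO, simB_sub]
      rw [h.lab, simL_emb ch h n, h.ex_desc (Q := fun m => SimO T' rest m (f out))
        (S := fun z => SimB T' c z) (fun m => ih m) (fun z => simB_emb c h z)]

theorem simO_reach (T : RTree A) (p : OPat A) (n out : T.Node) (h : SimO T p n out) :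
    Relation.ReflTransGen T.E n out := by
  induction p generalizing n with
  | here s ch => rw [SimO] at h; rw [h.1]
  | step s ch el rest ih =>
    cases el with
    | none =>
      simp only [SimO] at h
      obtain ⟨_, _, m, h1, h2⟩ := h
      exact .head h1 (ih m h2)
    | some c =>
      simp only [SimO] at h
      obtain ⟨_, _, m, h1, h2, _⟩ := h
      exact h1.to_reflTransGen.trans (ih m h2)

theorem simL_append (T : RTree A) (l l' : List (Option (BPat A) × BPat A)) (n : T.Node) :
    SimL T (l ++ l') n ↔ SimL T l n ∧ SimL T l' n := by
  induction l with
  | nil => simp [SimL]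
  | cons a l ih =>
    obtain ⟨_ | c, t⟩ := a <;> simp only [List.cons_append, SimL, ih, and_assoc]

theorem simB_fuse (T : RTree A) (p q : BPat A) (n : T.Node) :
    SimB T (p.fuse q) n ↔ SimB T p n ∧ SimB T q n := by
  cases p; cases q
  simp only [BPat.fuse, SimB, simL_append, Set.union_subset_iff]; tauto

theorem simB_graft (T : RTree A) (p : OPat A) (q : BPat A) (n : T.Node) :
    SimB T (p.graft q) n ↔ ∃ m, SimO T p n m ∧ SimB T q m := by
  induction p generalizing n with
  | here s ch =>
    cases q
    simp only [OPat.graft, SimB, SimO, simL_append, Set.union_subset_iff]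
    constructor
    · rintro ⟨⟨a, b⟩, c, d⟩; exact ⟨n, ⟨rfl, a, c⟩, b, d⟩
    · rintro ⟨_, ⟨rfl, a, c⟩, b, d⟩; exact ⟨⟨a, b⟩, c, d⟩
  | step s ch el rest ih =>
    cases el with
    | none =>
      simp only [OPat.graft, SimB, SimO, SimL, simL_append, ih]
      constructor
      · rintro ⟨a, b, ⟨m, c, k, d, e⟩, _⟩; exact ⟨k, ⟨a, b, m, c, d⟩, e⟩
      · rintro ⟨k, ⟨a, b, m, c, d⟩, e⟩; exact ⟨a, b, ⟨m, c, k, d, e⟩, trivial⟩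
    | some c =>
      simp only [OPat.graft, SimB, SimO, SimL, simL_append, ih]
      constructor
      · rintro ⟨a, b, ⟨m, c, ⟨k, d, e⟩, g⟩, _⟩; exact ⟨k, ⟨a, b, m, c, d, g⟩, e⟩
      · rintro ⟨k, ⟨a, b, m, c, d, g⟩, e⟩; exact ⟨a, b, ⟨m, c, ⟨k, d, e⟩, g⟩, trivial⟩

theorem simO_comp (T : RTree A) (p q : OPat A) (n out : T.Node) :
    SimO T (p.comp q) n out ↔ ∃ m, SimO T p n m ∧ SimO T q m out := by
  induction p generalizing n with
  | here s ch =>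
    have key : SimO T ((OPat.here s ch).comp q) n out ↔
        (s ⊆ T.label n ∧ SimL T ch n) ∧ SimO T q n out := by
      cases q with
      | here s' ch' =>
        simp only [OPat.comp, SimO, simL_append, Set.union_subset_iff]; tauto
      | step s' ch' el rest =>
        simp only [OPat.comp, SimO, simL_append, Set.union_subset_iff]; tauto
    rw [key]
    simp only [SimO]
    constructor
    · rintro ⟨a, b⟩; exact ⟨n, ⟨rfl, a⟩, b⟩
    · rintro ⟨_, ⟨rfl, a⟩, b⟩; exact ⟨a, b⟩
  | step s ch el rest ih =>
    cases el with
    | none =>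
      simp only [OPat.comp, SimO, ih]
      constructor
      · rintro ⟨a, b, m, c, k, d, e⟩; exact ⟨k, ⟨a, b, m, c, d⟩, e⟩
      · rintro ⟨k, ⟨a, b, m, c, d⟩, e⟩; exact ⟨a, b, m, c, k, d, e⟩
    | some c =>
      simp only [OPat.comp, SimO, ih]
      constructor
      · rintro ⟨a, b, m, c, ⟨k, d, e⟩, g⟩; exact ⟨k, ⟨a, b, m, c, d, g⟩, e⟩
      · rintro ⟨k, ⟨a, b, m, c, d, g⟩, e⟩; exact ⟨a, b, m, c, ⟨k, d, e⟩, g⟩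

open Relation in
theorem cstar_iff (T : RTree A) (hT : T.IsPreTree) (S : T.Node → Prop) (n m : T.Node) :
    (∃ k, ReflTransGen (fun a b => T.E a b ∧ S b) n k ∧ T.E k m) ↔
    (TransGen T.E n m ∧ ∀ z, TransGen T.E n z → TransGen T.E z m → S z) := by
  obtain ⟨-, -, hu, hac⟩ := hT
  have par : ∀ {z k m}, TransGen T.E z m → T.E k m → ReflTransGen T.E z k := by
    intro z k m h hk
    obtain ⟨k', h1, h2⟩ := TransGen.tail'_iff.1 h
    rw [hu m k k' hk h2]; exact h1
  have chain : ∀ k, ReflTransGen (fun a b => T.E a b ∧ S b) n k →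
      ReflTransGen T.E n k ∧ ∀ z, TransGen T.E n z → ReflTransGen T.E z k → S z := by
    intro k h
    induction h with
    | refl => exact ⟨.refl, fun z h1 h2 => (hac n (h1.trans_left h2)).elim⟩
    | tail _ hh ih =>
      refine ⟨ih.1.tail hh.1, fun z h1 h2 => ?_⟩
      rcases reflTransGen_iff_eq_or_transGen.1 h2 with rfl | h3
      · exact hh.2
      · exact ih.2 z h1 (par h3 hh.1)
  constructor
  · rintro ⟨k, h1, h2⟩
    have := chain k h1
    exact ⟨TransGen.tail' this.1 h2, fun z hz hm => this.2 z hz (par hm h2)⟩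
  · rintro ⟨h1, h2⟩
    obtain ⟨k, h3, h4⟩ := TransGen.tail'_iff.1 h1
    refine ⟨k, ?_, h4⟩
    have h5 : ∀ z, TransGen T.E n z → ReflTransGen T.E z k → S z :=
      fun z a b => h2 z a (TransGen.tail' b h4)
    clear h1 h2 h4
    induction h3 with
    | refl => exact .refl
    | tail a b ih =>
      exact (ih fun z c d => h5 z c (d.tail b)).tail ⟨b, h5 _ (TransGen.tail' a b) .refl⟩

mutual
theorem sat_iff (T : RTree A) (hT : T.IsPreTree) (φ : CNF A) (n : T.Node) :
    n ∈ CNF.sat T φ ↔ SimB T (ctN φ) n := by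
  match φ with
  | .lab p => simp [CNF.sat, ctN, SimB, SimL]
  | .top => simp [CNF.sat, ctN, SimB, SimL]
  | .and φ ψ =>
    rw [ctN, simB_fuse, ← sat_iff T hT φ, ← sat_iff T hT ψ, CNF.sat]; rfl
  | .dia α φ =>
    rw [ctN, simB_graft, CNF.sat]
    exact exists_congr fun m => and_congr (sem_iff T hT α n m) (sat_iff T hT φ m)
theorem sem_iff (T : RTree A) (hT : T.IsPreTree) (α : CPF A) (n m : T.Node) :
    CPF.sem T α n m ↔ SimO T (ctP α) n m := by
  match α with
  | .child => simp [CPF.sem, ctP, SimO, SimL]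
  | .test φ =>
    have := sat_iff T hT φ n
    simp only [CPF.sem, ctP, this]
    cases ctN φ
    simp only [SimB, SimO, eq_comm]
  | .comp α β =>
    rw [ctP, simO_comp, CPF.sem]
    exact exists_congr fun k => and_congr (sem_iff T hT α n k) (sem_iff T hT β k m)
  | .cstar φ =>
    have h1 := sat_iff T hT φ
    simp only [CPF.sem]
    rw [cstar_iff T hT (fun b => b ∈ CNF.sat T φ)]
    simp [ctP, SimO, SimL, simB_sub, h1]
end

/-- Simulation characterization for CTP path formulas: a CTP path
formula α relates nodes n and n' of a tree T iff n' lies in the subtree T.n and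
there is a simulation from the conditional tree pattern ct(α) into the pointed
tree (T.n, n) mapping the output node of ct(α) to n'. -/
theorem ctp_path_simulation (T : RTree A) (hT : T.IsTree)
    (α : CPF A) (n n' : T.Node) :
    CPF.sem T α n n' ↔
      ∃ h : Relation.ReflTransGen T.E n n',
        SimO (T.subtree n) (ctP α) (T.subtree n).root ⟨n', h⟩ := by
  rw [sem_iff T hT.1]
  constructor
  · intro h
    have hr := simO_reach T _ n n' h
    exact ⟨hr, (simO_emb (ctP α) (Emb.sub T n) (T.subtree n).root ⟨n', hr⟩).2 h⟩
  · rintro ⟨hr, h⟩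
    exact (simO_emb (ctP α) (Emb.sub T n) (T.subtree n).root ⟨n', hr⟩).1 h
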